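/- Let X be a nonempty weakly compact subset of a Banach space E with the Opial property, and T : X → X a mapping admitting a subinvariant metric functional h ∈ X^◇ (h(Tx) ≤ h(x) for all x ∈ X). Then T has a fixed point in X. -/

import Mathlib

open Filter

lemma aux_cont {E : Type*} [NormedAddCommGroup E] [NormedSpace ℝ E] (f : E →L[ℝ] ℝ) :
    Continuous (fun z : WeakSpace ℝ E => f ((toWeakSpace ℝ E).symm z)) :=
  WeakBilin.eval_continuous (topDualPairing ℝ E).flip f

lemma aux_ultra {E : Type*} [NormedAddCommGroup E] [NormedSpace ℝ E]
    {X : Set E} (hXwc : IsCompact (toWeakSpace ℝ E '' X)) {ι : Type*} (U : Ultrafilter ι)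
    (w : ι → E) (hw : ∀ i, w i ∈ X) :
    ∃ y ∈ X, ∀ f : E →L[ℝ] ℝ, Tendsto (fun i => f (w i)) U (nhds (f y)) := by
  obtain ⟨z, ⟨y, hy, rfl⟩, hz⟩ := hXwc.ultrafilter_le_nhds
    (U.map (fun i => toWeakSpace ℝ E (w i))) (by
      rw [le_principal_iff]
      exact Filter.mem_map.2 (Filter.univ_mem' fun i => ⟨w i, hw i, rfl⟩))
  refine ⟨y, hy, fun f => ?_⟩
  have h1 : Tendsto (fun i => toWeakSpace ℝ E (w i)) U (nhds (toWeakSpace ℝ E y)) := hz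
  have h2 := ((aux_cont f).tendsto (toWeakSpace ℝ E y)).comp h1
  simpa [Function.comp_def] using h2

lemma aux_bdd {E : Type*} [NormedAddCommGroup E] [NormedSpace ℝ E]
    {X : Set E} (hXwc : IsCompact (toWeakSpace ℝ E '' X)) :
    ∃ C, ∀ x ∈ X, ‖x‖ ≤ C := by
  obtain ⟨C, hC⟩ := banach_steinhaus
    (g := fun x : X => NormedSpace.inclusionInDoubleDual ℝ E (x : E)) (by
      intro f
      obtain ⟨C, hC⟩ := hXwc.exists_bound_of_continuousOn (aux_cont f).continuousOn
      refine ⟨C, fun x => ?_⟩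
      simpa using hC _ ⟨x, x.2, rfl⟩)
  refine ⟨C, fun x hx => ?_⟩
  have := hC ⟨x, hx⟩
  rwa [show ‖NormedSpace.inclusionInDoubleDual ℝ E x‖ = ‖x‖ from
    (NormedSpace.inclusionInDoubleDualLi (E := E) ℝ).norm_map x] at this

/-- Norming functionals for a dense sequence of the span of a finite set. -/
lemma aux_norming {E : Type*} [NormedAddCommGroup E] [NormedSpace ℝ E] (S : Finset E) :
    ∃ g : ℕ → (E →L[ℝ] ℝ), ∀ v ∈ Submodule.span ℝ (S : Set E), (∀ ε > 0, ∃ k, ∃ d : E,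
      ‖v - d‖ < ε ∧ ‖g k‖ ≤ 1 ∧ g k d = ‖d‖) := by
  have : FiniteDimensional ℝ (Submodule.span ℝ (S : Set E)) :=
    FiniteDimensional.span_finset ℝ S
  have : TopologicalSpace.SeparableSpace (Submodule.span ℝ (S : Set E)) := by
    have := FiniteDimensional.proper_real (Submodule.span ℝ (S : Set E))
    infer_instance
  choose g hg1 hg2 using fun k : ℕ => exists_dual_vector'' ℝ
    ((TopologicalSpace.denseSeq (Submodule.span ℝ (S : Set E)) k : _) : E)
  refine ⟨g, fun v hv ε hε => ?_⟩
  obtain ⟨k, hk⟩ := (TopologicalSpace.denseRange_denseSeq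
    (Submodule.span ℝ (S : Set E))).exists_dist_lt ⟨v, hv⟩ hε
  exact ⟨k, _, by simpa [dist_eq_norm] using hk, hg1 k, by simpa using hg2 k⟩

lemma aux_key {E : Type*} [NormedAddCommGroup E] [NormedSpace ℝ E]
    {X : Set E} (hXwc : IsCompact (toWeakSpace ℝ E '' X))
    (U : Ultrafilter X) (a x : E)
    (ha : ∀ f : E →L[ℝ] ℝ, Tendsto (fun i : X => f (i : E)) U (nhds (f a)))
    (r s : ℝ) (hr : Tendsto (fun i : X => ‖(i : E) - a‖) U (nhds r))
    (hs : Tendsto (fun i : X => ‖(i : E) - x‖) U (nhds s)) :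
    ∃ w : ℕ → E, (∀ f : E →L[ℝ] ℝ, Tendsto (fun n => f (w n)) atTop (nhds (f a))) ∧
      Tendsto (fun n => ‖w n - a‖) atTop (nhds r) ∧
      Tendsto (fun n => ‖w n - x‖) atTop (nhds s) := by
  classical
  choose g hg using fun S : Finset E => aux_norming S
  have step : ∀ (S : Finset E) (n : ℕ), ∃ w : X, |‖(w : E) - a‖ - r| < 1 / ((n : ℝ) + 1) ∧
      |‖(w : E) - x‖ - s| < 1 / ((n : ℝ) + 1) ∧
      ∀ T ∈ S.powerset, ∀ k ∈ Finset.range (n + 1),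
        |g T k (w : E) - g T k a| < 1 / ((n : ℝ) + 1) := by
    intro S n
    have hpos : (0 : ℝ) < 1 / ((n : ℝ) + 1) := by positivity
    have e1 := Metric.tendsto_nhds.1 hr _ hpos
    have e2 := Metric.tendsto_nhds.1 hs _ hpos
    have e3 : ∀ᶠ w : X in (U : Filter X), ∀ T ∈ S.powerset, ∀ k ∈ Finset.range (n + 1),
        |g T k (w : E) - g T k a| < 1 / ((n : ℝ) + 1) := by
      rw [Filter.eventually_all_finset]
      intro T _
      rw [Filter.eventually_all_finset]
      intro k _
      exact Metric.tendsto_nhds.1 (ha (g T k)) _ hpos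
    exact (e1.and (e2.and e3)).exists
  choose W hW1 hW2 hW3 using step
  obtain ⟨S, hS0, hS1⟩ : ∃ S : ℕ → Finset E, S 0 = {a} ∧
      ∀ n, S (n + 1) = insert ((W (S n) n : X) : E) (S n) :=
    ⟨fun n => Nat.rec {a} (fun n S => insert ((W S n : X) : E) S) n, rfl, fun n => rfl⟩
  have hSm : Monotone S := monotone_nat_of_le_succ fun n => by
    rw [hS1]; exact Finset.subset_insert _ _
  have hlim : Tendsto (fun n : ℕ => 1 / ((n : ℝ) + 1)) atTop (nhds 0) :=
    tendsto_one_div_add_atTop_nhds_zero_nat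
  refine ⟨fun n => (W (S n) n : X), ?_, ?_, ?_⟩
  · let K : Submodule ℝ E := ⨆ n : ℕ, Submodule.span ℝ (S n : Set E)
    have hdir : Directed (· ≤ ·) (fun n : ℕ => Submodule.span ℝ (S n : Set E)) :=
      Monotone.directed_le fun m n hmn => Submodule.span_mono (by exact_mod_cast hSm hmn)
    have hK : ∀ v, v ∈ K ↔ ∃ n, v ∈ Submodule.span ℝ (S n : Set E) := fun v =>
      Submodule.mem_iSup_of_directed _ hdir
    have haK : a ∈ K := (hK a).2 ⟨0, Submodule.subset_span (by simp [hS0])⟩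
    have hwK : ∀ n, ((W (S n) n : X) : E) ∈ K := fun n =>
      (hK _).2 ⟨n + 1, Submodule.subset_span (by simp [hS1])⟩
    have hgl : ∀ m k, Tendsto (fun n => g (S m) k ((W (S n) n : X) : E)) atTop
        (nhds (g (S m) k a)) := by
      intro m k
      rw [tendsto_iff_dist_tendsto_zero]
      refine squeeze_zero' (Eventually.of_forall fun _ => dist_nonneg) ?_ hlim
      filter_upwards [eventually_ge_atTop m, eventually_ge_atTop k] with n hm hk
      exact (hW3 (S n) n (S m) (Finset.mem_powerset.2 (hSm hm)) k
        (Finset.mem_range.2 (by omega))).le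
    intro f
    rw [tendsto_iff_ultrafilter]
    intro V hV
    obtain ⟨y, hy, hyV⟩ := aux_ultra hXwc V (fun n => ((W (S n) n : X) : E))
      (fun n => (W (S n) n).2)
    suffices y = a by rw [← this]; exact hyV f
    have hyK : y ∈ closure (K : Set E) := by
      by_contra hn
      obtain ⟨f, u, h1, h2⟩ := geometric_hahn_banach_closed_point
        K.convex.closure isClosed_closure hn
      have := le_of_tendsto (hyV f)
        (Eventually.of_forall fun n => (h1 _ (subset_closure (hwK n))).le)
      linarith
    have hgy : ∀ m k, g (S m) k y = g (S m) k a := fun m k =>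
      tendsto_nhds_unique (hyV _) ((hgl m k).mono_left hV)
    rw [← sub_eq_zero, ← norm_le_zero_iff]
    refine le_of_forall_pos_le_add fun ε hε => ?_
    obtain ⟨v, hv, hyv⟩ := Metric.mem_closure_iff.1 hyK (ε / 4) (by positivity)
    obtain ⟨m, hm⟩ := (hK (v - a)).1 (K.sub_mem hv haK)
    obtain ⟨k, d, hd, hg1, hg2⟩ := hg (S m) (v - a) hm (ε / 4) (by positivity)
    rw [dist_eq_norm] at hyv
    have e1 : ‖y - a - d‖ < ε / 2 := by
      have : y - a - d = (y - v) + (v - a - d) := by abel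
      rw [this]
      exact (norm_add_le _ _).trans_lt (by linarith)
    have e2 : ‖d‖ ≤ ‖y - a - d‖ := by
      have h3 : g (S m) k (y - a - d) = -‖d‖ := by
        rw [map_sub, map_sub, hgy, hg2]; ring
      have h4 := (g (S m) k).le_of_opNorm_le hg1 (y - a - d)
      rw [h3, norm_neg, norm_norm, one_mul] at h4
      exact h4
    have e3 : ‖y - a‖ ≤ ‖y - a - d‖ + ‖d‖ := by
      simpa using norm_add_le (y - a - d) d
    linarith
  · rw [tendsto_iff_dist_tendsto_zero]
    exact squeeze_zero (fun _ => dist_nonneg) (fun n => (hW1 (S n) n).le) hlim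
  · rw [tendsto_iff_dist_tendsto_zero]
    exact squeeze_zero (fun _ => dist_nonneg) (fun n => (hW2 (S n) n).le) hlim

/-- If `X` is a nonempty weakly compact subset of a Banach space with the Opial property
and `T : X → X` admits a subinvariant metric functional, then `T` has a fixed point. -/
theorem stmt_16 {E : Type*} [NormedAddCommGroup E] [NormedSpace ℝ E] [CompleteSpace E]
    (opial : ∀ (a : ℕ → E) (l : E),
      (∀ f : E →L[ℝ] ℝ, Tendsto (fun n => f (a n)) atTop (nhds (f l))) →
      ∀ x : E, x ≠ l →
        liminf (fun n => ‖a n - l‖) atTop < liminf (fun n => ‖a n - x‖) atTop)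
    (X : Set E) (hX : X.Nonempty) (hXwc : IsCompact (toWeakSpace ℝ E '' X))
    (T : X → X)
    (h : X → ℝ)
    (hmem : h ∈ closure (Set.range fun w : X =>
      (fun x : X => ‖(x : E) - (w : E)‖ - ‖(w : E)‖)))
    (hsub : ∀ x : X, h (T x) ≤ h x) :
    ∃ a : X, T a = a := by
  have hne : (comap (fun w : X => (fun x : X => ‖(x : E) - (w : E)‖ - ‖(w : E)‖))
      (nhds h)).NeBot := by
    refine comap_neBot fun t ht => ?_
    obtain ⟨_, h1, w, rfl⟩ := mem_closure_iff_nhds.1 hmem t ht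
    exact ⟨w, h1⟩
  let U : Ultrafilter X := Ultrafilter.of
    (comap (fun w : X => (fun x : X => ‖(x : E) - (w : E)‖ - ‖(w : E)‖)) (nhds h))
  have hU : Tendsto (fun w : X => (fun x : X => ‖(x : E) - (w : E)‖ - ‖(w : E)‖)) U (nhds h) :=
    tendsto_comap.mono_left (Ultrafilter.of_le _)
  rw [tendsto_pi_nhds] at hU
  obtain ⟨a, haX, ha⟩ := aux_ultra hXwc U (fun w : X => (w : E)) (fun w => w.2)
  obtain ⟨C, hC⟩ := aux_bdd hXwc
  have hlim : ∀ x : E, ∃ r, Tendsto (fun w : X => ‖(w : E) - x‖) U (nhds r) := by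
    intro x
    obtain ⟨r, _, hr⟩ := (isCompact_Icc (a := (0 : ℝ)) (b := C + ‖x‖)).ultrafilter_le_nhds
      (U.map (fun w : X => ‖(w : E) - x‖)) (by
        rw [le_principal_iff]
        refine Filter.mem_map.2 (Filter.univ_mem' fun w => ⟨norm_nonneg _, ?_⟩)
        have := hC w w.2
        exact (norm_sub_le _ _).trans (by linarith))
    exact ⟨r, hr⟩
  refine ⟨⟨a, haX⟩, ?_⟩
  by_contra hTa
  have hTa' : ((T ⟨a, haX⟩ : X) : E) ≠ a := fun h => hTa (Subtype.ext h)
  obtain ⟨r, hr⟩ := hlim a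
  obtain ⟨s, hs⟩ := hlim (T ⟨a, haX⟩ : X)
  obtain ⟨w, hw, hwr, hws⟩ := aux_key hXwc U a _ ha r s hr hs
  have h1 := opial w a hw _ hTa'
  rw [hwr.liminf_eq, hws.liminf_eq] at h1
  have h2 := (hU (T ⟨a, haX⟩)).sub (hU ⟨a, haX⟩)
  have h3 := tendsto_nhds_unique h2 ((hs.sub hr).congr fun w => by
    simp only [norm_sub_rev (w : E)]; ring)
  have := hsub ⟨a, haX⟩
  linarith
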